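/- arXiv:1110.2935 — 2 statements merged into one kernel-verified Lean document; each statement's English description precedes it below -/
import Mathlib

section
/- Let G be a simple graph, P a module of G such that G[P] is prime, and M a module of G with |M| ≥ 2. Then either P ∩ M = ∅ or P ⊆ M. -/
/-- `M` is a module of `G`: every vertex outside `M` is adjacent to all of `M` or to none. -/
def IsModule {V : Type*} (G : SimpleGraph V) (M : Set V) : Prop :=
  ∀ v ∉ M, (∀ m ∈ M, G.Adj v m) ∨ (∀ m ∈ M, ¬ G.Adj v m)

/-- `G` is prime: at least 4 vertices and only trivial modules. -/
def IsPrimeGraph {V : Type*} (G : SimpleGraph V) : Prop :=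
  4 ≤ Nat.card V ∧ ∀ M : Set V, IsModule G M → M = Set.univ ∨ M.Subsingleton

/-- The trace of a module of `G` on a vertex set `P` is a module of the subgraph induced on `P`. -/
theorem IsModule.preimage_val {V : Type*} {G : SimpleGraph V} {M : Set V} (hM : IsModule G M)
    (P : Set V) : IsModule (G.induce P) (Subtype.val ⁻¹' M) := fun v hv =>
  (hM v hv).imp (fun h m hm => h m hm) (fun h m hm => h m hm)

/-- In a prime graph no vertex is adjacent to all, or to none, of the other vertices. -/
theorem IsPrimeGraph.not_isModule_compl_singleton {V : Type*} {G : SimpleGraph V}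
    (hG : IsPrimeGraph G) (p : V) : ¬ IsModule G {p}ᶜ := by
  intro h
  rcases hG.2 _ h with h | h
  · have hp : p ∈ ({p}ᶜ : Set V) := h ▸ Set.mem_univ p
    exact hp rfl
  · have hcard := Set.ncard_add_ncard_compl {p}
      (Set.finite_singleton p) h.finite
    have hle : ({p}ᶜ : Set V).ncard ≤ 1 := (Set.ncard_le_one h.finite).2 fun a ha b hb => h ha hb
    have := hG.1
    rw [Set.ncard_singleton] at hcard
    omega

theorem prime_module_trichotomy {V : Type*} (G : SimpleGraph V) (P M : Set V)
    (hP : IsModule G P) (hprime : IsPrimeGraph (G.induce P))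
    (hM : IsModule G M) (h2 : 2 ≤ M.ncard) :
    P ∩ M = ∅ ∨ P ⊆ M := by
  rcases hprime.2 _ (hM.preimage_val P) with h | h
  · exact Or.inr fun x hx => (h ▸ Set.mem_univ (⟨x, hx⟩ : P) : _ ∈ Subtype.val ⁻¹' M)
  refine Or.inl (Set.eq_empty_iff_forall_notMem.2 fun p ⟨hpP, hpM⟩ => ?_)
  have huniq : ∀ x ∈ P, x ∈ M → x = p := fun x hx hxM =>
    congrArg Subtype.val (@h ⟨x, hx⟩ hxM ⟨p, hpP⟩ hpM)
  obtain ⟨m, hmM, hmp⟩ := Set.exists_ne_of_one_lt_ncard h2 p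
  have hmP : m ∉ P := fun hm => hmp (huniq m hm hmM)
  have key : ∀ x ∈ P, x ≠ p → (G.Adj p x ↔ G.Adj m x) := by
    intro x hx hxp
    rw [G.adj_comm p, G.adj_comm m]
    rcases hM x fun hxM => hxp (huniq x hx hxM) with h | h
    · exact iff_of_true (h p hpM) (h m hmM)
    · exact iff_of_false (h p hpM) (h m hmM)
  refine hprime.not_isModule_compl_singleton ⟨p, hpP⟩ fun v hv => ?_
  obtain rfl : v = ⟨p, hpP⟩ := not_not.1 hv
  exact (hP m hmP).imp
    (fun h x hx => (key x x.2 fun e => hx (Subtype.ext e)).2 (h x x.2))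
    (fun h x hx hadj => h x x.2 ((key x x.2 fun e => hx (Subtype.ext e)).1 hadj))
end

section
/- Let G be a finite graph with m(G) = 2^k for some k ≥ 1. Then p(G) = k + 1 if and only if G has exactly 2^k isolated vertices or the complement of G has exactly 2^k isolated vertices; otherwise p(G) = k. -/
/-- `M` is a clique: all distinct vertices of `M` are adjacent. -/
def IsCliqueSet {V : Type*} (G : SimpleGraph V) (M : Set V) : Prop :=
  ∀ a ∈ M, ∀ b ∈ M, a ≠ b → G.Adj a b

/-- `M` is a stable (independent) set. -/
def IsStableSet {V : Type*} (G : SimpleGraph V) (M : Set V) : Prop :=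
  ∀ a ∈ M, ∀ b ∈ M, ¬ G.Adj a b

/-- `G` admits a prime extension obtained by adding exactly `p` new vertices. -/
def HasPrimeExt {V : Type*} (G : SimpleGraph V) (p : ℕ) : Prop :=
  ∃ H : SimpleGraph (V ⊕ Fin p),
    (∀ a b : V, H.Adj (Sum.inl a) (Sum.inl b) ↔ G.Adj a b) ∧ IsPrimeGraph H

/-- The prime bound `p(G)`: the least number of added vertices in a prime extension. -/
noncomputable def primeBound {V : Type*} (G : SimpleGraph V) : ℕ :=
  sInf {p : ℕ | HasPrimeExt G p}

/-- `m(G)`: the largest cardinality of a module of `G` that is a clique or a stable set. -/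
noncomputable def modCliqueStab {V : Type*} (G : SimpleGraph V) : ℕ :=
  sSup {n : ℕ | ∃ M : Set V, IsModule G M ∧ (IsCliqueSet G M ∨ IsStableSet G M) ∧ M.ncard = n}

section Modules

variable {V : Type*} {G : SimpleGraph V}

theorem isModule_iff {M : Set V} :
    IsModule G M ↔ ∀ x ∉ M, ∀ a ∈ M, ∀ b ∈ M, G.Adj x a → G.Adj x b := by
  constructor
  · intro h x hx a ha b hb hab
    rcases h x hx with h | h
    · exact h b hb
    · exact absurd hab (h a ha)
  · intro h x hx
    by_cases hex : ∃ a ∈ M, G.Adj x a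
    · obtain ⟨a, ha, hxa⟩ := hex
      exact Or.inl fun b hb => h x hx a ha b hb hxa
    · push Not at hex
      exact Or.inr hex

theorem IsModule.adj_iff {M : Set V} (h : IsModule G M) {x a b : V} (hx : x ∉ M)
    (ha : a ∈ M) (hb : b ∈ M) : G.Adj x a ↔ G.Adj x b :=
  ⟨isModule_iff.1 h x hx a ha b hb, isModule_iff.1 h x hx b hb a ha⟩

theorem IsModule.compl {M : Set V} (h : IsModule G M) : IsModule Gᶜ M := by
  simp only [isModule_iff, SimpleGraph.compl_adj] at *
  rintro x hx a ha b hb ⟨-, hxa⟩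
  exact ⟨by rintro rfl; exact hx hb, fun hxb => hxa (h x hx b hb a ha hxb)⟩

theorem isModule_compl_iff {M : Set V} : IsModule Gᶜ M ↔ IsModule G M :=
  ⟨fun h => compl_compl G ▸ h.compl, IsModule.compl⟩

theorem IsModule.inter {A B : Set V} (hA : IsModule G A) (hB : IsModule G B) :
    IsModule G (A ∩ B) := by
  rw [isModule_iff] at *
  rintro x hx a ⟨ha, ha'⟩ b ⟨hb, hb'⟩ hab
  by_cases hxA : x ∈ A
  · exact hB x (fun h => hx ⟨hxA, h⟩) a ha' b hb' hab
  · exact hA x hxA a ha b hb hab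

theorem IsModule.union {A B : Set V} (hA : IsModule G A) (hB : IsModule G B)
    (hAB : (A ∩ B).Nonempty) : IsModule G (A ∪ B) := by
  obtain ⟨c, hcA, hcB⟩ := hAB
  rw [isModule_iff] at *
  intro x hx a ha b hb hab
  simp only [Set.mem_union, not_or] at hx
  have h1 : G.Adj x c := ha.elim (fun h => hA x hx.1 a h c hcA hab) fun h => hB x hx.2 a h c hcB hab
  exact hb.elim (fun h => hA x hx.1 c hcA b h h1) fun h => hB x hx.2 c hcB b h h1

theorem IsModule.diff {A B : Set V} (hA : IsModule G A) (hB : IsModule G B)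
    (hBA : (B \ A).Nonempty) : IsModule G (A \ B) := by
  obtain ⟨y, hyB, hyA⟩ := hBA
  rw [isModule_iff]
  rintro x hx a ⟨ha, ha'⟩ b ⟨hb, hb'⟩ hab
  by_cases hxA : x ∈ A
  · have hxB : x ∈ B := by by_contra h; exact hx ⟨hxA, h⟩
    have h1 := hB.adj_iff ha' hxB hyB
    have h2 := hB.adj_iff hb' hxB hyB
    have h3 := hA.adj_iff hyA ha hb
    rw [G.adj_comm x, h2, G.adj_comm, ← h3, G.adj_comm, ← h1, G.adj_comm]
    exact hab
  · exact isModule_iff.1 hA x hxA a ha b hb hab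

/-- Two vertices are twins when no other vertex distinguishes them. -/
def Twin (G : SimpleGraph V) (a b : V) : Prop :=
  ∀ x, x ≠ a → x ≠ b → (G.Adj x a ↔ G.Adj x b)

theorem Twin.refl (a : V) : Twin G a a := fun _ _ _ => Iff.rfl

theorem Twin.symm {a b : V} (h : Twin G a b) : Twin G b a :=
  fun x hb ha => (h x ha hb).symm

theorem Twin.trans {a b c : V} (hab : Twin G a b) (hbc : Twin G b c) : Twin G a c := by
  intro x hxa hxc
  by_cases hxb : x = b
  · subst hxb
    by_cases hac : a = c
    · rw [hac]
    have h1 := hab c (Ne.symm hac) (Ne.symm hxc)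
    have h2 := hbc a (Ne.symm hxa) hac
    rw [G.adj_comm x a, G.adj_comm x c, h2, ← h1, G.adj_comm]
  · exact (hab x hxa hxb).trans (hbc x hxb hxc)

theorem twin_compl_iff {a b : V} : Twin Gᶜ a b ↔ Twin G a b := by
  refine forall_congr' fun x => forall_congr' fun ha => forall_congr' fun hb => ?_
  simp only [SimpleGraph.compl_adj]
  tauto

theorem isModule_pair_iff {a b : V} : IsModule G {a, b} ↔ Twin G a b := by
  constructor
  · intro h x ha hb
    exact h.adj_iff (by simp [ha, hb]) (by simp) (by simp)
  · intro h
    rw [isModule_iff]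
    rintro x hx c hc d hd hcd
    simp only [Set.mem_insert_iff, Set.mem_singleton_iff, not_or] at hx hc hd
    have := h x hx.1 hx.2
    rcases hc with rfl | rfl <;> rcases hd with rfl | rfl <;> tauto

theorem IsModule.twin {M : Set V} (hM : IsModule G M)
    (h : IsCliqueSet G M ∨ IsStableSet G M) {a b : V} (ha : a ∈ M) (hb : b ∈ M) :
    Twin G a b := by
  intro x hxa hxb
  by_cases hx : x ∈ M
  · rcases h with h | h
    · exact iff_of_true (h x hx a ha hxa) (h x hx b hb hxb)
    · exact iff_of_false (h x hx a ha) (h x hx b hb)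
  · exact hM.adj_iff hx ha hb

/-- The set of twins of `u`, including `u` itself. -/
def twinClass (G : SimpleGraph V) (u : V) : Set V := {w | Twin G u w}

theorem mem_twinClass_self (u : V) : u ∈ twinClass G u := Twin.refl u

theorem twinClass_eq {u w : V} (h : Twin G u w) : twinClass G w = twinClass G u :=
  Set.ext fun _ => ⟨fun hx => Twin.trans h hx, fun hx => (Twin.symm h).trans hx⟩

theorem twinClass_compl (u : V) : twinClass Gᶜ u = twinClass G u :=
  Set.ext fun _ => twin_compl_iff

theorem isModule_twinClass (u : V) : IsModule G (twinClass G u) := by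
  rw [isModule_iff]
  intro x hx a ha b hb hab
  have h : Twin G a b := (Twin.symm ha).trans hb
  exact (h x (by rintro rfl; exact hx ha) (by rintro rfl; exact hx hb)).1 hab

theorem twinClass_clique_or_stable (u : V) :
    IsCliqueSet G (twinClass G u) ∨ IsStableSet G (twinClass G u) := by
  by_cases hex : ∃ a ∈ twinClass G u, ∃ b ∈ twinClass G u, G.Adj a b
  · left
    obtain ⟨a, ha, b, hb, hab⟩ := hex
    have key : ∀ c ∈ twinClass G u, c ≠ a → G.Adj c a := fun c hc hca =>
      (((Twin.symm hb).trans hc a hab.ne (Ne.symm hca)).1 hab).symm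
    intro c hc d hd hcd
    by_cases hca : c = a
    · subst hca
      exact (key d hd (Ne.symm hcd)).symm
    · by_cases hda : d = a
      · subst hda
        exact key c hc hca
      · exact ((Twin.symm ha).trans hd c hca hcd).1 (key c hc hca)
  · right
    push Not at hex
    exact hex

/-- A vertex without neighbors. -/
def IsIso (G : SimpleGraph V) (u : V) : Prop := ∀ w, ¬ G.Adj u w

theorem IsIso.twin {u w : V} (hu : IsIso G u) (hw : IsIso G w) : Twin G u w :=
  fun x _ _ => iff_of_false (fun h => hu x h.symm) fun h => hw x h.symm

theorem IsIso.of_twin {u w : V} (hu : IsIso G u) (h : Twin G u w) : IsIso G w := by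
  intro x hx
  by_cases hxu : x = u
  · subst hxu
    exact hu w hx.symm
  · exact hu x ((h x hxu hx.ne').2 hx.symm).symm

theorem IsIso.twinClass_eq {u : V} (hu : IsIso G u) : twinClass G u = {v | IsIso G v} :=
  Set.ext fun _ => ⟨fun h => hu.of_twin h, fun h => hu.twin h⟩

theorem IsIso.not_compl [Nontrivial V] {u : V} (hu : IsIso G u) : ¬ IsIso Gᶜ u := by
  intro h
  obtain ⟨w, hw⟩ := exists_ne u
  exact h w ((SimpleGraph.compl_adj _ _ _).2 ⟨hw.symm, hu w⟩)

theorem IsIso.isModule_compl {u : V} (hu : IsIso G u) : IsModule G ({u}ᶜ : Set V) := by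
  rw [isModule_iff]
  intro x hx a _ b _ hab
  simp only [Set.mem_compl_iff, Set.mem_singleton_iff, not_not] at hx
  subst hx
  exact absurd hab (hu a)

theorem IsPrimeGraph.not_isIso {G : SimpleGraph V} (hG : IsPrimeGraph G) (u : V) :
    ¬ IsIso G u := by
  intro hu
  have : Finite V := Nat.finite_of_card_ne_zero (by have := hG.1; omega)
  rcases hG.2 _ hu.isModule_compl with h | h
  · have : u ∈ ({u}ᶜ : Set V) := h ▸ Set.mem_univ u
    exact this rfl
  · have h1 := Set.ncard_add_ncard_compl ({u} : Set V)
    have h2 := Set.ncard_le_one_iff_subsingleton.2 h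
    rw [Set.ncard_singleton] at h1
    have := hG.1
    omega

theorem IsPrimeGraph.eq_of_twin {G : SimpleGraph V} (hG : IsPrimeGraph G) {a b : V}
    (h : Twin G a b) : a = b := by
  have : Finite V := Nat.finite_of_card_ne_zero (by have := hG.1; omega)
  rcases hG.2 _ (isModule_pair_iff.2 h) with h | h
  · have h1 := Set.ncard_insert_le a {b}
    rw [Set.ncard_singleton] at h1
    rw [h, Set.ncard_univ] at h1
    have := hG.1
    omega
  · exact h (by simp) (by simp)

theorem IsPrimeGraph.compl {G : SimpleGraph V} (hG : IsPrimeGraph G) : IsPrimeGraph Gᶜ :=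
  ⟨hG.1, fun M hM => hG.2 M (isModule_compl_iff.1 hM)⟩

end Modules

section LowerBound

variable {V : Type*} {G : SimpleGraph V}

theorem HasPrimeExt.compl {p : ℕ} (h : HasPrimeExt G p) : HasPrimeExt Gᶜ p := by
  obtain ⟨H, hH, hp⟩ := h
  refine ⟨Hᶜ, fun a b => ?_, hp.compl⟩
  simp [hH]

theorem injOn_trace {p : ℕ} {H : SimpleGraph (V ⊕ Fin p)}
    (hH : ∀ a b : V, H.Adj (Sum.inl a) (Sum.inl b) ↔ G.Adj a b) (hp : IsPrimeGraph H)
    {M : Set V} (hM : ∀ a ∈ M, ∀ b ∈ M, Twin G a b) :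
    Set.InjOn (fun v => {i : Fin p | H.Adj (Sum.inr i) (Sum.inl v)}) M := by
  intro a ha b hb hab
  have : Twin H (Sum.inl a) (Sum.inl b) := by
    rintro (x | i) hxa hxb
    · rw [hH, hH]
      exact hM a ha b hb x (fun h => hxa (h ▸ rfl)) (fun h => hxb (h ▸ rfl))
    · exact Set.ext_iff.1 hab i
  exact Sum.inl_injective (hp.eq_of_twin this)

theorem HasPrimeExt.ncard_le {p : ℕ} (h : HasPrimeExt G p)
    {M : Set V} (hM : ∀ a ∈ M, ∀ b ∈ M, Twin G a b) : M.ncard ≤ 2 ^ p := by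
  obtain ⟨H, hH, hp⟩ := h
  rw [← (injOn_trace hH hp hM).ncard_image]
  refine (Set.ncard_le_card _).trans ?_
  simp

theorem HasPrimeExt.ncard_isIso_lt {p : ℕ} (h : HasPrimeExt G p) :
    {v | IsIso G v}.ncard < 2 ^ p := by
  obtain ⟨H, hH, hp⟩ := h
  rw [← (injOn_trace hH hp (M := {v | IsIso G v}) fun a ha b hb => IsIso.twin ha hb).ncard_image]
  have : (2 : ℕ) ^ p = (Set.univ : Set (Set (Fin p))).ncard := by simp [Set.ncard_univ]
  rw [this]
  refine Set.ncard_lt_ncard ((Set.ssubset_univ_iff).2 fun huniv => ?_)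
  obtain ⟨v, hv, hve⟩ := huniv.symm ▸ Set.mem_univ (∅ : Set (Fin p))
  refine hp.not_isIso (Sum.inl v) ?_
  rintro (x | i) hx
  · exact hv x ((hH _ _).1 hx)
  · have : i ∈ (∅ : Set (Fin p)) := hve ▸ hx.symm
    exact this

end LowerBound

section AddVertex

variable {V : Type*} {G : SimpleGraph V} {N : Set V}

/-- The extension of `G` by one vertex `none` whose set of neighbors is `N`. -/
def addVertex (G : SimpleGraph V) (N : Set V) : SimpleGraph (Option V) where
  Adj
    | some a, some b => G.Adj a b
    | some a, none => a ∈ N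
    | none, some b => b ∈ N
    | none, none => False
  symm := ⟨by
    rintro (_ | a) (_ | b) h
    · exact h
    · exact h
    · exact h
    · exact SimpleGraph.Adj.symm h⟩
  loopless := ⟨by
    rintro (_ | a) h
    · exact h
    · exact G.loopless.irrefl a h⟩

/-- `N` distinguishes two vertices in each module with at least two vertices. -/
def Splits (G : SimpleGraph V) (N : Set V) : Prop :=
  ∀ M, IsModule G M → ¬ M.Subsingleton → (∃ a ∈ M, a ∈ N) ∧ ∃ b ∈ M, b ∉ N

/-- No proper nonempty module becomes a module after adding a vertex with neighborhood `N`
to it. -/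
def Avoids (G : SimpleGraph V) (N : Set V) : Prop :=
  ∀ M, IsModule G M → M.Nonempty → M ≠ Set.univ →
    ∃ x ∉ M, ∃ m ∈ M, ¬ (x ∈ N ↔ G.Adj x m)

theorem Splits.of_compl (h : Splits Gᶜ N) : Splits G Nᶜ := by
  intro M hM hs
  obtain ⟨⟨a, ha, ha'⟩, b, hb, hb'⟩ := h M hM.compl hs
  exact ⟨⟨b, hb, hb'⟩, a, ha, fun h => h ha'⟩

theorem Avoids.of_compl (h : Avoids Gᶜ N) : Avoids G Nᶜ := by
  intro M hM hne hu
  obtain ⟨x, hx, m, hm, hxm⟩ := h M hM.compl hne hu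
  refine ⟨x, hx, m, hm, fun h' => hxm ?_⟩
  have : x ≠ m := by rintro rfl; exact hx hm
  simp only [SimpleGraph.compl_adj, Set.mem_compl_iff] at *
  tauto

theorem isPrimeGraph_addVertex [Finite V] (hV : 3 ≤ Nat.card V) (hs : Splits G N)
    (ha : Avoids G N) : IsPrimeGraph (addVertex G N) := by
  refine ⟨by rw [Finite.card_option]; omega, fun M hM => ?_⟩
  have hM' : IsModule G (some ⁻¹' M) := by
    rw [isModule_iff] at *
    intro x hx a ha b hb hab
    exact hM (some x) hx (some a) ha (some b) hb hab
  by_cases hn : none ∈ M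
  · by_cases hne : (some ⁻¹' M).Nonempty
    · by_cases hu : some ⁻¹' M = Set.univ
      · left
        ext x
        cases x with
        | none => simpa using hn
        | some x => simpa using Set.ext_iff.1 hu x
      · obtain ⟨x, hx, m, hm, hxm⟩ := ha _ hM' hne hu
        exact absurd (hM.adj_iff hx hn hm) hxm
    · right
      rw [Set.not_nonempty_iff_eq_empty] at hne
      rintro (_ | x) hx (_ | y) hy
      · rfl
      · exact absurd hy (Set.ext_iff.1 hne y).1
      · exact absurd hx (Set.ext_iff.1 hne x).1
      · exact absurd hx (Set.ext_iff.1 hne x).1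
  · right
    by_contra hns
    obtain ⟨⟨a, ha, haN⟩, b, hb, hbN⟩ := hs _ hM' (by
      intro hsub
      apply hns
      rintro (_ | x) hx (_ | y) hy
      · rfl
      · exact absurd hx hn
      · exact absurd hy hn
      · exact congrArg some (hsub hx hy))
    exact hbN ((hM.adj_iff hn ha hb).1 haN)

/-- An inclusion-minimal module among those with at least two vertices. -/
def IsMinModule (G : SimpleGraph V) (A : Set V) : Prop :=
  Minimal (fun M => IsModule G M ∧ ¬ M.Subsingleton) A

theorem IsMinModule.isModule {A : Set V} (h : IsMinModule G A) : IsModule G A := h.prop.1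

theorem IsMinModule.not_subsingleton {A : Set V} (h : IsMinModule G A) : ¬ A.Subsingleton :=
  h.prop.2

theorem IsMinModule.subsingleton {A B : Set V} (h : IsMinModule G A) (hB : IsModule G B)
    (hBA : B ⊂ A) : B.Subsingleton := by
  by_contra hs
  exact hBA.not_subset (h.le_of_le ⟨hB, hs⟩ hBA.subset)

theorem exists_isMinModule_subset [Finite V] {M : Set V} (hM : IsModule G M)
    (hs : ¬ M.Subsingleton) : ∃ A ⊆ M, IsMinModule G A := by
  obtain ⟨A, hA, hmin⟩ := (Set.toFinite {M : Set V | IsModule G M ∧ ¬ M.Subsingleton}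
    ).exists_le_minimal ⟨hM, hs⟩
  exact ⟨A, hA, hmin⟩

theorem isMinModule_compl_iff {A : Set V} : IsMinModule Gᶜ A ↔ IsMinModule G A := by
  simp [IsMinModule, isModule_compl_iff]

theorem IsMinModule.eq_of_inter_nonempty [Finite V]
    (htw : ∀ u, (twinClass G u).ncard ≤ 2) {A B : Set V}
    (hA : IsMinModule G A) (hB : IsMinModule G B) (hAB : (A ∩ B).Nonempty) : A = B := by
  by_contra hne
  obtain ⟨c, hcA, hcB⟩ := hAB
  have main : ∀ A B : Set V, IsMinModule G A → IsMinModule G B → A ≠ B → c ∈ A → c ∈ B →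
      ∃ a, a ∈ A ∧ a ∉ B ∧ Twin G c a := by
    intro A B hA hB hne hcA hcB
    have hAB : ¬ A ⊆ B := fun h => hne (h.antisymm (hB.le_of_le hA.prop h))
    have hBA : ¬ B ⊆ A := fun h => hne ((hA.le_of_le hB.prop h).antisymm h)
    obtain ⟨a, haA, haB⟩ := Set.not_subset.1 hAB
    have h1 : (A ∩ B).Subsingleton :=
      hA.subsingleton (hA.isModule.inter hB.isModule)
        ⟨Set.inter_subset_left, fun h => haB (h haA).2⟩
    have h2 : (A \ B).Subsingleton :=
      hA.subsingleton (hA.isModule.diff hB.isModule (Set.not_subset.1 hBA))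
        ⟨Set.sdiff_subset, fun h => (h hcA).2 hcB⟩
    refine ⟨a, haA, haB, isModule_pair_iff.1 ?_⟩
    convert hA.isModule using 1
    ext x
    constructor
    · rintro (rfl | rfl)
      · exact hcA
      · exact haA
    · intro hx
      by_cases hxB : x ∈ B
      · exact Or.inl (h1 ⟨hx, hxB⟩ ⟨hcA, hcB⟩)
      · exact Or.inr (h2 ⟨hx, hxB⟩ ⟨haA, haB⟩)
  obtain ⟨a, haA, haB, hca⟩ := main A B hA hB hne hcA hcB
  obtain ⟨b, hbB, hbA, hcb⟩ := main B A hB hA (Ne.symm hne) hcB hcA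
  have hsub : ({c, a, b} : Set V) ⊆ twinClass G c := by
    rintro x (rfl | rfl | rfl)
    · exact mem_twinClass_self _
    · exact hca
    · exact hcb
  have hcard : ({c, a, b} : Set V).ncard = 3 := Set.ncard_eq_three.2
    ⟨c, a, b, by rintro rfl; exact haB hcB, by rintro rfl; exact hbA hcA,
      by rintro rfl; exact hbA haA, rfl⟩
  have := Set.ncard_le_ncard hsub
  have := htw c
  omega

theorem exists_splits [Finite V]
    (hdisj : ∀ A B, IsMinModule G A → IsMinModule G B → (A ∩ B).Nonempty → A = B)
    (D F : Set V) (hD : ∀ A, IsMinModule G A → Disjoint A D) :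
    ∃ N, Splits G N ∧ ∀ x ∈ D, (x ∈ N ↔ x ∈ F) := by
  have hex : ∀ A, IsMinModule G A → ∃ a, a ∈ A := fun A hA => by
    by_contra h
    push Not at h
    exact hA.not_subsingleton fun x hx => absurd hx (h x)
  choose f hf using hex
  refine ⟨{x | (x ∈ D ∧ x ∈ F) ∨ ∃ A hA, f A hA = x}, fun M hM hs => ?_, fun x hx => ?_⟩
  · obtain ⟨A, hAM, hA⟩ := exists_isMinModule_subset hM hs
    refine ⟨⟨f A hA, hAM (hf A hA), Or.inr ⟨A, hA, rfl⟩⟩, ?_⟩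
    obtain ⟨b, hb, hbf⟩ : ∃ b ∈ A, b ≠ f A hA := by
      by_contra h
      push Not at h
      exact hA.not_subsingleton fun x hx y hy => (h x hx).trans (h y hy).symm
    refine ⟨b, hAM hb, ?_⟩
    rintro (⟨hbD, -⟩ | ⟨B, hB, rfl⟩)
    · exact Set.disjoint_left.1 (hD A hA) hb hbD
    · obtain rfl := hdisj A B hA hB ⟨_, hb, hf B hB⟩
      exact hbf rfl
  · constructor
    · rintro (⟨-, h⟩ | ⟨A, hA, rfl⟩)
      · exact h
      · exact absurd hx (Set.disjoint_left.1 (hD A hA) (hf A hA))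
    · exact fun h => Or.inl ⟨hx, h⟩

theorem Splits.inter_nonempty (hs : Splits G N) {M A : Set V} (hA : IsModule G A)
    (hAs : ¬ A.Subsingleton) (hMne : M.Nonempty)
    (hM : ∀ x ∉ M, ∀ m ∈ M, (x ∈ N ↔ G.Adj x m)) : (M ∩ A).Nonempty := by
  by_contra hdis
  rw [Set.not_nonempty_iff_eq_empty, ← Set.disjoint_iff_inter_eq_empty] at hdis
  obtain ⟨m, hm⟩ := hMne
  obtain ⟨⟨a, ha, haN⟩, b, hb, hbN⟩ := hs A hA hAs
  have h1 := (hM a (Set.disjoint_right.1 hdis ha) m hm).1 haN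
  have h2 := (hA.adj_iff (Set.disjoint_left.1 hdis hm) ha hb).1 h1.symm
  exact hbN ((hM b (Set.disjoint_right.1 hdis hb) m hm).2 h2.symm)

/-- `S` is a union of connected components of `G`, neither empty nor everything. -/
def IsCut (G : SimpleGraph V) (S : Set V) : Prop :=
  S.Nonempty ∧ S ≠ Set.univ ∧ ∀ x ∈ S, ∀ y ∉ S, ¬ G.Adj x y

theorem exists_splits_avoids_of_isCut [Finite V]
    (hdisj : ∀ A B, IsMinModule G A → IsMinModule G B → (A ∩ B).Nonempty → A = B)
    (hiso : ∀ u w, IsIso G u → IsIso G w → u = w) {S : Set V} (hS : IsCut G S) :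
    ∃ N, Splits G N ∧ Avoids G N := by
  obtain ⟨N, hN, hNiso⟩ := exists_splits hdisj {u | IsIso G u} Set.univ (by
    intro A hA
    rw [Set.disjoint_left]
    intro u huA hu
    have hmod : IsModule G (A \ {u}) := by
      rw [isModule_iff]
      intro x hx a ha b hb hab
      by_cases hxA : x ∈ A
      · have : x = u := by by_contra h; exact hx ⟨hxA, h⟩
        subst this
        exact absurd hab (hu a)
      · exact isModule_iff.1 hA.isModule x hxA a ha.1 b hb.1 hab
    have hsub := hA.subsingleton hmod ⟨Set.sdiff_subset, fun h => (h huA).2 rfl⟩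
    obtain ⟨w, hwA, hwu⟩ : ∃ w ∈ A, w ≠ u := by
      by_contra h
      push Not at h
      exact hA.not_subsingleton fun x hx y hy => (h x hx).trans (h y hy).symm
    refine hwu (hiso w u (fun x hxw => ?_) hu)
    by_cases hxA : x ∈ A
    · by_cases hxu : x = u
      · subst hxu
        exact hu w hxw.symm
      · exact hxw.ne (hsub ⟨hwA, hwu⟩ ⟨hxA, hxu⟩)
    · exact hu x ((hA.isModule.adj_iff hxA hwA huA).1 hxw.symm).symm)
  refine ⟨N, hN, fun M hM hne hu => ?_⟩
  by_contra hbad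
  push Not at hbad
  have key : ∀ T : Set V, T.Nonempty → (∀ x ∈ T, ∀ y ∉ T, ¬ G.Adj x y) → (M ∩ T).Nonempty := by
    intro T hT hclosed
    by_cases hTs : T.Subsingleton
    · obtain ⟨t, ht⟩ := hT
      have htiso : IsIso G t := by
        intro y hy
        by_cases hyT : y ∈ T
        · exact hy.ne (hTs ht hyT)
        · exact hclosed t ht y hyT hy
      refine ⟨t, ?_, ht⟩
      by_contra htM
      obtain ⟨m, hm⟩ := hne
      exact htiso m ((hbad t htM m hm).1 ((hNiso t htiso).2 trivial))
    · refine hN.inter_nonempty (isModule_iff.2 ?_) hTs hne hbad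
      intro x hx a ha b _ hab
      exact absurd hab.symm (hclosed a ha x hx)
  obtain ⟨hSne, hSu, hSc⟩ := hS
  obtain ⟨s, hsM, hsS⟩ := key S hSne hSc
  obtain ⟨t, htM, htS⟩ := key Sᶜ (Set.nonempty_compl.2 hSu) (fun x hx y hy h =>
    hSc y (not_not.1 hy) x hx h.symm)
  obtain ⟨z, hzM, hz⟩ := key Mᶜ (Set.nonempty_compl.2 hu) (by
    intro x hx y hy h
    have hyM : y ∈ M := not_not.1 hy
    by_cases hxS : x ∈ S
    · exact hSc x hxS t htS ((hM.adj_iff hx hyM htM).1 h)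
    · exact hSc s hsS x hxS ((hM.adj_iff hx hyM hsM).1 h).symm)
  exact hz hzM

theorem IsModule.union_ne_univ (hc : ∀ S, ¬ IsCut G S) (hcc : ∀ S, ¬ IsCut Gᶜ S)
    {X Y : Set V} (hX : IsModule G X) (hY : IsModule G Y) (hXu : X ≠ Set.univ)
    (hYu : Y ≠ Set.univ) : X ∪ Y ≠ Set.univ := by
  have main : ∀ G : SimpleGraph V, (∀ S, ¬ IsCut G S) → IsModule G X → IsModule G Y →
      X ∪ Y = Set.univ → ∀ y ∈ Y, y ∉ X → ∃ x ∈ X, G.Adj y x := by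
    intro G hc hX hY hu y hyY hyX
    by_contra hno
    push Not at hno
    refine hc Y ⟨⟨y, hyY⟩, hYu, fun z hz x hx h => ?_⟩
    have hxX : x ∈ X := (Set.eq_univ_iff_forall.1 hu x).resolve_right hx
    exact hno x hxX ((hY.adj_iff hx hz hyY).1 h.symm).symm
  intro hu
  obtain ⟨y, hyX⟩ := (Set.ne_univ_iff_exists_notMem X).1 hXu
  have hyY : y ∈ Y := (Set.eq_univ_iff_forall.1 hu y).resolve_left hyX
  obtain ⟨a, ha, hya⟩ := main G hc hX hY hu y hyY hyX
  obtain ⟨b, hb, hyb⟩ := main Gᶜ hcc hX.compl hY.compl hu y hyY hyX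
  exact ((SimpleGraph.compl_adj _ _ _).1 hyb).2 ((hX.adj_iff hyX ha hb).1 hya)

theorem exists_splits_avoids_of_module [Finite V]
    (hdisj : ∀ A B, IsMinModule G A → IsMinModule G B → (A ∩ B).Nonempty → A = B)
    (hc : ∀ S, ¬ IsCut G S) (hcc : ∀ S, ¬ IsCut Gᶜ S) {X₀ : Set V} (hX₀ : IsModule G X₀)
    (hX₀s : ¬ X₀.Subsingleton) (hX₀u : X₀ ≠ Set.univ) : ∃ N, Splits G N ∧ Avoids G N := by
  obtain ⟨X, hX₀X, hXmax⟩ :=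
    (Set.toFinite {M : Set V | IsModule G M ∧ M ≠ Set.univ}).exists_le_maximal ⟨hX₀, hX₀u⟩
  obtain ⟨hX, hXu⟩ := hXmax.prop
  have hXs : ¬ X.Subsingleton := fun h => hX₀s (h.anti hX₀X)
  have habs : ∀ Y, IsModule G Y → Y ≠ Set.univ → (X ∩ Y).Nonempty → Y ⊆ X := by
    intro Y hY hYu hXY
    exact Set.subset_union_right.trans
      (hXmax.le_of_ge ⟨hX.union hY hXY, hX.union_ne_univ hc hcc hY hXu hYu⟩
        Set.subset_union_left)
  by_cases hout : ∃ A, IsMinModule G A ∧ ¬ (X ∩ A).Nonempty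
  · obtain ⟨A, hA, hXA⟩ := hout
    obtain ⟨N, hN, -⟩ := exists_splits hdisj ∅ ∅ (by simp)
    refine ⟨N, hN, fun M hM hne hu => ?_⟩
    by_contra hbad
    push Not at hbad
    have h1 := hN.inter_nonempty hX hXs hne hbad
    have h2 := hN.inter_nonempty hA.isModule hA.not_subsingleton hne hbad
    rw [Set.inter_comm] at h1
    exact hXA (h2.mono (Set.inter_subset_inter_left _ (habs M hM hu h1)))
  · push Not at hout
    have hin : ∀ A, IsMinModule G A → A ⊆ X := by
      intro A hA
      refine habs A hA.isModule ?_ (hout A hA)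
      rintro rfl
      exact hXu (Set.univ_subset_iff.1 (hA.le_of_le ⟨hX, hXs⟩ (Set.subset_univ X)))
    obtain ⟨N, hN, hNX⟩ := exists_splits hdisj Xᶜ {x | ∃ m ∈ X, ¬ G.Adj x m}
      (fun A hA => Set.disjoint_compl_right_iff_subset.2 (hin A hA))
    refine ⟨N, hN, fun M hM hne hu => ?_⟩
    by_contra hbad
    push Not at hbad
    have h1 := hN.inter_nonempty hX hXs hne hbad
    rw [Set.inter_comm] at h1
    have hMX := habs M hM hu h1
    obtain ⟨x, hx⟩ := (Set.ne_univ_iff_exists_notMem X).1 hXu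
    obtain ⟨m, hm⟩ := hne
    have h2 := hbad x (fun h => hx (hMX h)) m hm
    have h3 := hNX x hx
    by_cases hxm : G.Adj x m
    · obtain ⟨m', hm', hxm'⟩ := h3.1 (h2.2 hxm)
      exact hxm' ((hX.adj_iff hx (hMX hm) hm').1 hxm)
    · exact hxm (h2.1 (h3.2 ⟨m, hMX hm, hxm⟩))

theorem exists_splits_avoids_of_prime [Finite V] (hV : 3 ≤ Nat.card V)
    (hc : ∀ S, ¬ IsCut G S)
    (hprime : ∀ M, IsModule G M → M = Set.univ ∨ M.Subsingleton) :
    ∃ N, Splits G N ∧ Avoids G N := by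
  have hnt : Nontrivial V := Finite.one_lt_card_iff_nontrivial.1 (by omega)
  have hniso : ∀ f, ¬ IsIso G f := fun f hf => hc {f} ⟨⟨f, rfl⟩, by
    obtain ⟨w, hw⟩ := exists_ne f
    exact fun h => hw (h.symm ▸ Set.mem_univ w : w ∈ ({f} : Set V)), by
    rintro x rfl y - h
    exact hf y h⟩
  by_cases hex : ∃ f, ∀ a, ∃ x, x ≠ a ∧ ¬ (x = f ↔ G.Adj x a)
  · obtain ⟨f, hf⟩ := hex
    refine ⟨{f}, fun M hM hs => ?_, fun M hM hne hu => ?_⟩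
    · obtain rfl := (hprime M hM).resolve_right hs
      obtain ⟨w, hw⟩ := exists_ne f
      exact ⟨⟨f, trivial, rfl⟩, w, trivial, hw⟩
    · obtain ⟨m, hm⟩ := hne
      have hMs := (hprime M hM).resolve_left hu
      obtain ⟨x, hxm, hx⟩ := hf m
      exact ⟨x, fun h => hxm (hMs h hm), m, hm, hx⟩
  · exfalso
    push Not at hex
    choose leaf hleaf using hex
    have hne : ∀ f, leaf f ≠ f := by
      intro f h
      refine hniso f fun x hx => hx.ne' ((hleaf f x (by rw [h]; exact hx.ne')).2 ?_)
      rw [h]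
      exact hx.symm
    have hadj : ∀ f x, G.Adj x (leaf f) ↔ x = f := by
      intro f x
      by_cases hx : x = leaf f
      · subst hx
        exact iff_of_false (G.loopless.irrefl _) (hne f)
      · exact (hleaf f x hx).symm
    have hinj : Function.Injective leaf := by
      intro f g hfg
      exact (hadj g f).1 (hfg ▸ (hadj f f).2 rfl)
    have hsurj := Finite.surjective_of_injective hinj
    have hone : ∀ a, ∃ b, ∀ x, G.Adj x a ↔ x = b := by
      intro a
      obtain ⟨f, rfl⟩ := hsurj a
      exact ⟨f, hadj f⟩
    obtain ⟨a⟩ := hnt.to_nonempty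
    obtain ⟨b, hb⟩ := hone a
    obtain ⟨c, hbc⟩ := hone b
    have hca : a = c := (hbc a).1 ((hb b).2 rfl).symm
    subst hca
    refine hc {a, b} ⟨⟨a, by simp⟩, ?_, ?_⟩
    · intro h
      have h1 := Set.ncard_insert_le a {b}
      rw [Set.ncard_singleton] at h1
      rw [h, Set.ncard_univ] at h1
      omega
    · rintro x (rfl | rfl) y hy h
      · exact hy (Or.inr ((hb y).1 h.symm))
      · exact hy (Or.inl ((hbc y).1 h.symm))

theorem exists_isPrimeGraph_addVertex [Finite V] (hV : 3 ≤ Nat.card V)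
    (htw : ∀ u, (twinClass G u).ncard ≤ 2)
    (hiso : ∀ u w, IsIso G u → IsIso G w → u = w)
    (hcoiso : ∀ u w, IsIso Gᶜ u → IsIso Gᶜ w → u = w) :
    ∃ N, IsPrimeGraph (addVertex G N) := by
  suffices h : ∃ N, Splits G N ∧ Avoids G N by
    obtain ⟨N, hs, ha⟩ := h
    exact ⟨N, isPrimeGraph_addVertex hV hs ha⟩
  have hdisj : ∀ A B, IsMinModule G A → IsMinModule G B → (A ∩ B).Nonempty → A = B :=
    fun A B hA hB => hA.eq_of_inter_nonempty htw hB
  by_cases hc : ∃ S, IsCut G S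
  · obtain ⟨S, hS⟩ := hc
    exact exists_splits_avoids_of_isCut hdisj hiso hS
  by_cases hcc : ∃ S, IsCut Gᶜ S
  · obtain ⟨S, hS⟩ := hcc
    obtain ⟨N, hs, ha⟩ := exists_splits_avoids_of_isCut (G := Gᶜ)
      (by simpa only [isMinModule_compl_iff] using hdisj) hcoiso hS
    exact ⟨Nᶜ, hs.of_compl, ha.of_compl⟩
  push Not at hc hcc
  by_cases hX : ∃ X, IsModule G X ∧ ¬ X.Subsingleton ∧ X ≠ Set.univ
  · obtain ⟨X, hX, hXs, hXu⟩ := hX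
    exact exists_splits_avoids_of_module hdisj hc hcc hX hXs hXu
  · push Not at hX
    refine exists_splits_avoids_of_prime hV hc fun M hM => ?_
    by_cases hs : M.Subsingleton
    · exact Or.inr hs
    · exact Or.inl (hX M hM (Set.not_subsingleton_iff.1 hs))

end AddVertex

section UpperBound

universe u

/-- Every class of twins has at most `2 ^ k` vertices, and strictly fewer if it consists of
isolated vertices of `G` or of its complement. -/
structure TwinBound {V : Type*} (G : SimpleGraph V) (k : ℕ) : Prop where
  le : ∀ u, (twinClass G u).ncard ≤ 2 ^ k
  iso_lt : ∀ u, IsIso G u → (twinClass G u).ncard < 2 ^ k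
  coiso_lt : ∀ u, IsIso Gᶜ u → (twinClass G u).ncard < 2 ^ k

theorem ncard_twinClass_ge_two {V : Type*} [Finite V] {G : SimpleGraph V} {u w : V}
    (h : Twin G u w) (hne : u ≠ w) : 2 ≤ (twinClass G u).ncard := by
  rw [← Set.ncard_pair hne]
  refine Set.ncard_le_ncard ?_
  rintro x (rfl | rfl)
  · exact mem_twinClass_self _
  · exact h

theorem exists_ncard_twinClass_inter_eq {V : Type*} [Finite V] (G : SimpleGraph V)
    (g : Set V → ℕ) (hg : ∀ T, g T ≤ T.ncard) :
    ∃ N : Set V, ∀ u, (twinClass G u ∩ N).ncard = g (twinClass G u) := by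
  have hex : ∀ T : Set V, ∃ s ⊆ T, s.ncard = g T := fun T =>
    Set.exists_subset_card_eq (hg T)
  choose s hs hsg using hex
  refine ⟨{x | x ∈ s (twinClass G x)}, fun u => ?_⟩
  rw [← hsg]
  congr 1
  ext x
  constructor
  · rintro ⟨hx, hxs⟩
    rw [Set.mem_ofPred_eq, twinClass_eq hx] at hxs
    exact hxs
  · intro hx
    have hxu := hs _ hx
    refine ⟨hxu, ?_⟩
    rw [Set.mem_ofPred_eq, twinClass_eq hxu]
    exact hx

theorem exists_balanced {V : Type*} [Finite V] [Nontrivial V] (G : SimpleGraph V) :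
    ∃ N : Set V, ∀ u,
      (twinClass G u ∩ N).ncard ≤ ((twinClass G u).ncard + 1) / 2 ∧
      (twinClass G u \ N).ncard ≤ ((twinClass G u).ncard + 1) / 2 ∧
      (IsIso G u → (twinClass G u \ N).ncard ≤ (twinClass G u).ncard / 2) ∧
      (IsIso Gᶜ u → (twinClass G u ∩ N).ncard ≤ (twinClass G u).ncard / 2) := by
  classical
  obtain ⟨N, hN⟩ := exists_ncard_twinClass_inter_eq G
    (fun T => if ∃ v ∈ T, IsIso Gᶜ v then T.ncard / 2 else (T.ncard + 1) / 2)
    (fun T => by split_ifs <;> omega)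
  refine ⟨N, fun u => ?_⟩
  have h1 := hN u
  have h2 := Set.ncard_inter_add_ncard_sdiff_eq_ncard (twinClass G u) N
  by_cases hco : ∃ v ∈ twinClass G u, IsIso Gᶜ v
  · rw [if_pos hco] at h1
    obtain ⟨v, hv, hvco⟩ := hco
    have huco : IsIso Gᶜ u := hvco.of_twin (twin_compl_iff.2 (Twin.symm hv))
    refine ⟨by omega, by omega, fun hu => absurd huco hu.not_compl, fun _ => by omega⟩
  · rw [if_neg hco] at h1
    exact ⟨by omega, by omega, fun _ => by omega,
      fun hu => absurd ⟨u, mem_twinClass_self u, hu⟩ hco⟩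

section

variable {V : Type*} {G : SimpleGraph V} {N : Set V}

theorem twin_of_addVertex {u w : V} (h : Twin (addVertex G N) (some u) (some w)) :
    Twin G u w :=
  fun x hu hw => h (some x) (by simpa using hu) (by simpa using hw)

theorem mem_iff_of_twin_addVertex {u w : V} (h : Twin (addVertex G N) (some u) (some w)) :
    u ∈ N ↔ w ∈ N :=
  h none (by simp) (by simp)

theorem isIso_of_addVertex {u : V} (h : IsIso (addVertex G N) (some u)) :
    IsIso G u ∧ u ∉ N :=
  ⟨fun w => h (some w), h none⟩

theorem isIso_compl_of_addVertex {u : V} (h : IsIso (addVertex G N)ᶜ (some u)) :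
    IsIso Gᶜ u ∧ u ∈ N := by
  constructor
  · intro w hw
    refine h (some w) ?_
    rw [SimpleGraph.compl_adj] at *
    exact ⟨by simpa using hw.1, hw.2⟩
  · by_contra hu
    exact h none ((SimpleGraph.compl_adj _ _ _).2 ⟨by simp, hu⟩)

theorem eq_of_twin_none
    (hN : ∀ a b, Twin G a b → a ≠ b → (∃ z, Twin G a z ∧ z ∈ N) ∧ ∃ z, Twin G a z ∧ z ∉ N)
    {u w : V} (hu : Twin (addVertex G N) none (some u))
    (hw : Twin (addVertex G N) none (some w)) : u = w := by
  by_contra hne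
  have huw' := hu.symm.trans hw
  have huw := twin_of_addVertex huw'
  have hside := mem_iff_of_twin_addVertex huw'
  obtain ⟨⟨y, huy, hy⟩, z, huz, hz⟩ := hN u w huw hne
  have h1 : ∀ x, x ≠ u → (x ∈ N ↔ G.Adj x u) := fun x hx =>
    hu (some x) (by simp) (by simpa using hx)
  have h2 := h1 w (Ne.symm hne)
  have key : ∀ x, Twin G u x → x ≠ u → x ≠ w → (x ∈ N ↔ w ∈ N) := by
    intro x hux hxu hxw
    rw [h1 x hxu, h2, G.adj_comm x, G.adj_comm w]
    exact (huw.symm.trans hux u hne (Ne.symm hxu)).symm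
  by_cases hwN : w ∈ N
  · exact hz ((key z huz (by rintro rfl; tauto) (by rintro rfl; tauto)).2 hwN)
  · exact hwN ((key y huy (by rintro rfl; tauto) (by rintro rfl; tauto)).1 hy)

theorem twinClass_none_subset
    (hN : ∀ a b, Twin G a b → a ≠ b → (∃ z, Twin G a z ∧ z ∈ N) ∧ ∃ z, Twin G a z ∧ z ∉ N) :
    ∃ a, twinClass (addVertex G N) none ⊆ {none, a} := by
  by_cases hex : ∃ u, Twin (addVertex G N) none (some u)
  · obtain ⟨u, hu⟩ := hex
    refine ⟨some u, ?_⟩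
    rintro (_ | w) hw
    · simp
    · rw [eq_of_twin_none hN hu hw]
      simp
  · push Not at hex
    refine ⟨none, ?_⟩
    rintro (_ | w) hw
    · simp
    · exact absurd hw (hex w)

end

theorem TwinBound.exists_addVertex {V : Type*} [Finite V] [Nontrivial V] {G : SimpleGraph V}
    {k : ℕ} (hk : 1 ≤ k) (h : TwinBound G (k + 1)) : ∃ N, TwinBound (addVertex G N) k := by
  obtain ⟨N, hN⟩ := exists_balanced G
  refine ⟨N, ?_⟩
  have hpow : (2 : ℕ) ^ (k + 1) = 2 * 2 ^ k := by ring
  have htwo : 2 ≤ 2 ^ k := by simpa using Nat.pow_le_pow_right (n := 2) (by norm_num) hk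
  have hcard : ∀ u, (twinClass G u ∩ N).ncard + (twinClass G u \ N).ncard =
      (twinClass G u).ncard := fun u => Set.ncard_inter_add_ncard_sdiff_eq_ncard _ _
  have hsplit : ∀ a b, Twin G a b → a ≠ b →
      (∃ z, Twin G a z ∧ z ∈ N) ∧ ∃ z, Twin G a z ∧ z ∉ N := by
    intro a b hab hne
    have h2 := ncard_twinClass_ge_two hab hne
    obtain ⟨h3, h4, -, -⟩ := hN a
    have h5 := hcard a
    constructor
    · obtain ⟨z, hz, hzN⟩ := Set.nonempty_of_ncard_ne_zero
        (show (twinClass G a ∩ N).ncard ≠ 0 by omega)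
      exact ⟨z, hz, hzN⟩
    · obtain ⟨z, hz, hzN⟩ := Set.nonempty_of_ncard_ne_zero
        (show (twinClass G a \ N).ncard ≠ 0 by omega)
      exact ⟨z, hz, hzN⟩
  obtain ⟨a, ha⟩ := twinClass_none_subset hsplit
  have hnone_le : (twinClass (addVertex G N) none).ncard ≤ 2 := by
    refine (Set.ncard_le_ncard ha).trans ((Set.ncard_insert_le _ _).trans ?_)
    rw [Set.ncard_singleton]
  have hnone_lt : (∀ u, ¬ Twin (addVertex G N) none (some u)) →
      (twinClass (addVertex G N) none).ncard < 2 ^ k := by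
    intro hno
    have hsub : twinClass (addVertex G N) none ⊆ {none} := by
      rintro (_ | w) hw
      · rfl
      · exact absurd hw (hno w)
    have := Set.ncard_le_ncard hsub
    rw [Set.ncard_singleton] at this
    omega
  have hnone_iso : IsIso (addVertex G N) none →
      (twinClass (addVertex G N) none).ncard < 2 ^ k := by
    intro hiso
    refine hnone_lt fun u hu => ?_
    have hGu := (isIso_of_addVertex (hiso.of_twin hu)).1
    have hempty : twinClass G u ∩ N = ∅ :=
      Set.eq_empty_of_forall_notMem fun x hx => hiso (some x) hx.2
    have h1 := (hN u).2.2.1 hGu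
    have h2 := hcard u
    have h3 := (Set.ncard_pos (Set.toFinite _)).2 ⟨u, mem_twinClass_self (G := G) u⟩
    rw [hempty, Set.ncard_empty] at h2
    omega
  have hnone_coiso : IsIso (addVertex G N)ᶜ none →
      (twinClass (addVertex G N) none).ncard < 2 ^ k := by
    intro hiso
    refine hnone_lt fun u hu => ?_
    have hGu := (isIso_compl_of_addVertex (hiso.of_twin (twin_compl_iff.2 hu))).1
    have hempty : twinClass G u \ N = ∅ :=
      Set.eq_empty_of_forall_notMem fun x hx =>
        hiso (some x) ((SimpleGraph.compl_adj _ _ _).2 ⟨by simp, hx.2⟩)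
    have h1 := (hN u).2.2.2 hGu
    have h2 := hcard u
    have h3 := (Set.ncard_pos (Set.toFinite _)).2 ⟨u, mem_twinClass_self (G := G) u⟩
    rw [hempty, Set.ncard_empty] at h2
    omega
  have hsome_mem : ∀ u, ¬ Twin (addVertex G N) none (some u) → u ∈ N →
      (twinClass (addVertex G N) (some u)).ncard ≤ (twinClass G u ∩ N).ncard := by
    intro u hu huN
    rw [← Set.ncard_image_of_injective _ (Option.some_injective V)]
    refine Set.ncard_le_ncard ?_
    rintro (_ | w) hw
    · exact absurd (Twin.symm hw) hu
    · exact ⟨w, ⟨twin_of_addVertex hw, (mem_iff_of_twin_addVertex hw).1 huN⟩, rfl⟩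
  have hsome_notMem : ∀ u, ¬ Twin (addVertex G N) none (some u) → u ∉ N →
      (twinClass (addVertex G N) (some u)).ncard ≤ (twinClass G u \ N).ncard := by
    intro u hu huN
    rw [← Set.ncard_image_of_injective _ (Option.some_injective V)]
    refine Set.ncard_le_ncard ?_
    rintro (_ | w) hw
    · exact absurd (Twin.symm hw) hu
    · exact ⟨w, ⟨twin_of_addVertex hw, fun h => huN ((mem_iff_of_twin_addVertex hw).2 h)⟩, rfl⟩
  refine ⟨fun u => ?_, fun u hu => ?_, fun u hu => ?_⟩
  · by_cases hn : Twin (addVertex G N) none u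
    · rw [twinClass_eq hn]
      omega
    · cases u with
      | none => exact absurd (Twin.refl none) hn
      | some u =>
        have h1 := h.le u
        obtain ⟨h2, h3, -, -⟩ := hN u
        by_cases huN : u ∈ N
        · have := hsome_mem u hn huN
          omega
        · have := hsome_notMem u hn huN
          omega
  · by_cases hn : Twin (addVertex G N) none u
    · rw [twinClass_eq hn]
      exact hnone_iso (hu.of_twin hn.symm)
    · cases u with
      | none => exact absurd (Twin.refl none) hn
      | some u =>
        obtain ⟨hGu, huN⟩ := isIso_of_addVertex hu
        have h1 := h.iso_lt u hGu
        have h2 := (hN u).2.2.1 hGu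
        have h3 := hsome_notMem u hn huN
        omega
  · by_cases hn : Twin (addVertex G N) none u
    · rw [twinClass_eq hn]
      exact hnone_coiso (hu.of_twin (twin_compl_iff.2 hn.symm))
    · cases u with
      | none => exact absurd (Twin.refl none) hn
      | some u =>
        obtain ⟨hGu, huN⟩ := isIso_compl_of_addVertex hu
        have h1 := h.coiso_lt u hGu
        have h2 := (hN u).2.2.2 hGu
        have h3 := hsome_mem u hn huN
        omega

theorem TwinBound.exists_isPrimeGraph_addVertex {V : Type*} [Finite V] [Nontrivial V]
    {G : SimpleGraph V} (h : TwinBound G 1) : ∃ N, IsPrimeGraph (addVertex G N) := by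
  have hiso : ∀ u w, IsIso G u → IsIso G w → u = w := by
    intro u w hu hw
    by_contra hne
    have h1 := ncard_twinClass_ge_two (hu.twin hw) hne
    have h2 := h.iso_lt u hu
    omega
  have hcoiso : ∀ u w, IsIso Gᶜ u → IsIso Gᶜ w → u = w := by
    intro u w hu hw
    by_contra hne
    have h1 := ncard_twinClass_ge_two (twin_compl_iff.1 (hu.twin hw)) hne
    have h2 := h.coiso_lt u hu
    omega
  refine _root_.exists_isPrimeGraph_addVertex ?_ h.le hiso hcoiso
  by_contra hV
  obtain ⟨a, b, hab⟩ := exists_pair_ne V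
  have hall : ∀ x, x = a ∨ x = b := by
    intro x
    by_contra hx
    push Not at hx
    have h3 : ({x, a, b} : Set V).ncard = 3 :=
      Set.ncard_eq_three.2 ⟨x, a, b, hx.1, hx.2, hab, rfl⟩
    have := Set.ncard_le_card ({x, a, b} : Set V)
    omega
  by_cases hadj : G.Adj a b
  · refine hab (hcoiso a b (fun w hw => ?_) fun w hw => ?_) <;>
      rw [SimpleGraph.compl_adj] at hw <;> rcases hall w with rfl | rfl
    · exact hw.1 rfl
    · exact hw.2 hadj
    · exact hw.2 hadj.symm
    · exact hw.1 rfl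
  · refine hab (hiso a b (fun w hw => ?_) fun w hw => ?_) <;> rcases hall w with rfl | rfl
    · exact hw.ne rfl
    · exact hadj hw
    · exact hadj hw.symm
    · exact hw.ne rfl

theorem TwinBound.exists_embedding (k : ℕ) : ∀ {V : Type u} [Finite V] [Nontrivial V]
    {G : SimpleGraph V}, TwinBound G (k + 1) → ∃ (W : Type u) (_ : Finite W)
      (H : SimpleGraph W) (_ : G ↪g H),
      IsPrimeGraph H ∧ Nat.card W = Nat.card V + (k + 1) := by
  have emb : ∀ {V : Type u} (G : SimpleGraph V) (N : Set V), Nonempty (G ↪g addVertex G N) :=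
    fun G N => ⟨⟨⟨some, Option.some_injective _⟩, Iff.rfl⟩⟩
  induction k with
  | zero =>
    intro V _ _ G h
    obtain ⟨N, hN⟩ := h.exists_isPrimeGraph_addVertex
    obtain ⟨e⟩ := emb G N
    exact ⟨Option V, inferInstance, _, e, hN, Finite.card_option⟩
  | succ k ih =>
    intro V _ _ G h
    obtain ⟨N, hN⟩ := h.exists_addVertex (by omega)
    obtain ⟨W, hW, H, e, hH, hcard⟩ := ih hN
    obtain ⟨e'⟩ := emb G N
    refine ⟨W, hW, H, e'.trans e, hH, ?_⟩
    rw [hcard, Finite.card_option]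
    omega

theorem IsPrimeGraph.of_iso {V W : Type*} {G : SimpleGraph V} {H : SimpleGraph W}
    (e : G ≃g H) (h : IsPrimeGraph H) : IsPrimeGraph G := by
  refine ⟨by rw [Nat.card_congr e.toEquiv]; exact h.1, fun M hM => ?_⟩
  have hM' : IsModule H (e.symm ⁻¹' M) := by
    rw [isModule_iff] at *
    intro x hx a ha b hb hab
    exact e.symm.map_rel_iff.1 (hM _ hx _ ha _ hb (e.symm.map_rel_iff.2 hab))
  rcases h.2 _ hM' with h | h
  · left
    ext x
    simpa using Set.ext_iff.1 h (e x)
  · right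
    intro x hx y hy
    exact e.injective (h (by simpa using hx) (by simpa using hy))

theorem hasPrimeExt_of_embedding {V W : Type*} [Finite V] [Finite W] {G : SimpleGraph V}
    {H : SimpleGraph W} (e : G ↪g H) (hH : IsPrimeGraph H) {p : ℕ}
    (hcard : Nat.card W = Nat.card V + p) : HasPrimeExt G p := by
  classical
  have hcompl : Nat.card ((Set.range e)ᶜ : Set W) = p := by
    have h1 := Set.ncard_add_ncard_compl (Set.range e)
    rw [← Set.image_univ, Set.ncard_image_of_injective _ e.injective, Set.ncard_univ,
      Set.image_univ] at h1
    rw [Nat.card_coe_set_eq]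
    omega
  let f : V ⊕ Fin p ≃ W :=
    (Equiv.sumCongr (Equiv.ofInjective e e.injective)
      (Finite.equivFinOfCardEq hcompl).symm).trans (Equiv.Set.sumCompl (Set.range e))
  have hf : ∀ a, f (Sum.inl a) = e a := fun a => by simp [f]
  refine ⟨H.comap f, fun a b => ?_, IsPrimeGraph.of_iso (SimpleGraph.Iso.comap f H) hH⟩
  rw [SimpleGraph.comap_adj, hf, hf]
  exact e.map_rel_iff

theorem TwinBound.hasPrimeExt {V : Type*} [Finite V] [Nontrivial V] {G : SimpleGraph V} {k : ℕ}
    (hk : 1 ≤ k) (h : TwinBound G k) : HasPrimeExt G k := by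
  obtain ⟨k, rfl⟩ := Nat.exists_eq_add_of_le' hk
  obtain ⟨W, _, H, e, hH, hcard⟩ := TwinBound.exists_embedding k h
  exact hasPrimeExt_of_embedding e hH hcard

end UpperBound

section ModCliqueStab

variable {V : Type*} [Finite V] (G : SimpleGraph V)

theorem bddAbove_modCliqueStab : BddAbove {n : ℕ | ∃ M : Set V, IsModule G M ∧
    (IsCliqueSet G M ∨ IsStableSet G M) ∧ M.ncard = n} :=
  ⟨Nat.card V, by rintro _ ⟨M, -, -, rfl⟩; exact Set.ncard_le_card M⟩

theorem ncard_twinClass_le_modCliqueStab (u : V) :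
    (twinClass G u).ncard ≤ modCliqueStab G :=
  le_csSup (bddAbove_modCliqueStab G)
    ⟨_, isModule_twinClass u, twinClass_clique_or_stable u, rfl⟩

theorem exists_twins_ncard_eq_modCliqueStab :
    ∃ M : Set V, (∀ a ∈ M, ∀ b ∈ M, Twin G a b) ∧ M.ncard = modCliqueStab G := by
  obtain ⟨M, hM, hcs, hcard⟩ := Nat.sSup_mem (s := {n : ℕ | ∃ M : Set V, IsModule G M ∧
    (IsCliqueSet G M ∨ IsStableSet G M) ∧ M.ncard = n})
    ⟨0, ∅, fun v _ => Or.inr (by simp), Or.inr (by simp [IsStableSet]), Set.ncard_empty V⟩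
    (bddAbove_modCliqueStab G)
  exact ⟨M, fun a ha b hb => hM.twin hcs ha hb, hcard⟩

end ModCliqueStab

theorem primeBound_eq {V : Type*} {G : SimpleGraph V} {p : ℕ} (h : HasPrimeExt G p)
    (hmin : ∀ q, HasPrimeExt G q → p ≤ q) : primeBound G = p :=
  le_antisymm (Nat.sInf_le h) (le_csInf ⟨p, h⟩ hmin)

theorem prime_bound_power_of_two {V : Type*} [Finite V] (G : SimpleGraph V)
    (k : ℕ) (hk : 1 ≤ k) (hm : modCliqueStab G = 2 ^ k) :
    (primeBound G = k + 1 ↔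
      ({v : V | ∀ w : V, ¬ G.Adj v w}.ncard = 2 ^ k ∨
        {v : V | ∀ w : V, ¬ Gᶜ.Adj v w}.ncard = 2 ^ k)) ∧
    (¬ ({v : V | ∀ w : V, ¬ G.Adj v w}.ncard = 2 ^ k ∨
        {v : V | ∀ w : V, ¬ Gᶜ.Adj v w}.ncard = 2 ^ k) → primeBound G = k) := by
  obtain ⟨M, hM, hMcard⟩ := exists_twins_ncard_eq_modCliqueStab G
  rw [hm] at hMcard
  have hle : ∀ u, (twinClass G u).ncard ≤ 2 ^ k :=
    fun u => hm ▸ ncard_twinClass_le_modCliqueStab G u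
  have hlower : ∀ q, HasPrimeExt G q → k ≤ q := fun q hq =>
    (Nat.pow_le_pow_iff_right (by norm_num)).1 (hMcard ▸ hq.ncard_le hM)
  have hnt : Nontrivial V := by
    rw [← Finite.one_lt_card_iff_nontrivial]
    have h1 := Set.ncard_le_card M
    have h2 : 2 ^ 1 ≤ 2 ^ k := Nat.pow_le_pow_right (by norm_num) hk
    omega
  change (primeBound G = k + 1 ↔
    ({v | IsIso G v}.ncard = 2 ^ k ∨ {v | IsIso Gᶜ v}.ncard = 2 ^ k)) ∧
    (¬ ({v | IsIso G v}.ncard = 2 ^ k ∨ {v | IsIso Gᶜ v}.ncard = 2 ^ k) → primeBound G = k)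
  have hsucc : ({v | IsIso G v}.ncard = 2 ^ k ∨ {v | IsIso Gᶜ v}.ncard = 2 ^ k) →
      primeBound G = k + 1 := by
    intro hiso
    have hpow : 2 ^ k < 2 ^ (k + 1) := Nat.pow_lt_pow_right (by norm_num) (by omega)
    refine primeBound_eq (TwinBound.hasPrimeExt (by omega)
      ⟨fun u => (hle u).trans hpow.le, fun u _ => (hle u).trans_lt hpow,
        fun u _ => (hle u).trans_lt hpow⟩) fun q hq => ?_
    have h1 := hlower q hq
    rcases h1.eq_or_lt with rfl | h1
    · have h2 := hq.ncard_isIso_lt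
      have h3 := hq.compl.ncard_isIso_lt
      omega
    · exact h1
  have hself : ¬ ({v | IsIso G v}.ncard = 2 ^ k ∨ {v | IsIso Gᶜ v}.ncard = 2 ^ k) →
      primeBound G = k := by
    intro hiso
    push Not at hiso
    refine primeBound_eq (TwinBound.hasPrimeExt hk ⟨hle, fun u hu => ?_, fun u hu => ?_⟩) hlower
    · exact lt_of_le_of_ne (hle u) (hu.twinClass_eq ▸ hiso.1)
    · refine lt_of_le_of_ne (hle u) ?_
      rw [← twinClass_compl, hu.twinClass_eq]
      exact hiso.2
  refine ⟨⟨fun h => ?_, hsucc⟩, hself⟩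
  by_contra hno
  have := hself hno
  omega
end
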